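/- Let w ≥ 0 be an integer, let G be a finite simple graph, let s, t be distinct vertices of G, and let H be a subgraph of G with V(H) = V(G) and tw(H) ≤ w. Suppose uv is an edge of the (s,t)-relevant part G_{s,t} such that tw(H + uv) > w. Then tw(G_{s,t} + st) > w. -/

import Mathlib

/-- A tree decomposition of a simple graph `G`: a finite nonempty tree `T` together with
bags such that every vertex's set of bags is nonempty and induces a connected subtree,
and every edge is contained in some bag. -/
structure TreeDecomp {V : Type} (G : SimpleGraph V) where
  ι : Type
  instFin : Fintype ι
  T : SimpleGraph ι
  isTree : T.IsTree
  bag : ι → Finset V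
  bag_conn : ∀ v : V, (SimpleGraph.induce {i | v ∈ bag i} T).Connected
  bag_edge : ∀ ⦃u v : V⦄, G.Adj u v → ∃ i, u ∈ bag i ∧ v ∈ bag i

/-- The width of a tree decomposition: maximum bag size minus 1. -/
noncomputable def TreeDecomp.width {V : Type} {G : SimpleGraph V} (td : TreeDecomp G) : ℕ :=
  (@Finset.univ td.ι td.instFin).sup (fun i => (td.bag i).card) - 1

/-- The treewidth of a graph: the minimum width over all tree decompositions. -/
noncomputable def treewidth {V : Type} (G : SimpleGraph V) : ℕ :=
  sInf {w | ∃ td : TreeDecomp G, td.width = w}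

/-- `G + uv`: the graph obtained from `G` by adding the edge `uv`. -/
def addEdge {V : Type} (G : SimpleGraph V) (u v : V) : SimpleGraph V :=
  G ⊔ SimpleGraph.fromEdgeSet {s(u, v)}

/-- The vertex set of the `(s,t)`-relevant part of `G`: all vertices lying on at least one
simple `(s,t)`-path. -/
def relevantSet {V : Type} (G : SimpleGraph V) (s t : V) : Set V :=
  {v | ∃ p : G.Walk s t, p.IsPath ∧ v ∈ p.support}

namespace SimpleGraph

section Paths

variable {V : Type*} {G : SimpleGraph V}

/-- Two paths meeting only at their common endpoint concatenate to a path. -/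
lemma Walk.IsPath.append_of_inter {u v w : V} {p : G.Walk u v} {q : G.Walk v w}
    (hp : p.IsPath) (hq : q.IsPath) (h : ∀ x ∈ p.support, x ∈ q.support → x = v) :
    (p.append q).IsPath := by
  induction p with
  | nil => simpa using hq
  | @cons a b c hab p ih =>
    rw [Walk.cons_isPath_iff] at hp
    rw [Walk.cons_append, Walk.cons_isPath_iff, Walk.mem_support_append_iff]
    refine ⟨ih hp.1 hq fun x hx => h x (by simp [hx]), ?_⟩
    rintro (ha | ha)
    · exact hp.2 ha
    · have := h a (by simp) ha
      subst this
      exact hp.2 p.end_mem_support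

lemma Walk.IsPath.inter_of_append {u v w : V} {p : G.Walk u v} {q : G.Walk v w}
    (h : (p.append q).IsPath) {x : V} (hp : x ∈ p.support) (hq : x ∈ q.support) : x = v := by
  induction p with
  | nil => simpa using hp
  | @cons a b c hab p ih =>
    rw [Walk.cons_append, Walk.cons_isPath_iff, Walk.mem_support_append_iff] at h
    rw [Walk.support_cons, List.mem_cons] at hp
    rcases hp with rfl | hp
    · exact absurd (Or.inr hq) h.2
    · exact ih h.1 hp hq

/-- A walk ending in a set `S` has an initial path which meets `S` exactly at its end. -/
lemma Walk.exists_isPath_first_hit {x y : V} (p : G.Walk x y) (S : Set V) (hy : y ∈ S) :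
    ∃ (z : V) (q : G.Walk x z), z ∈ S ∧ q.IsPath ∧ q.support ⊆ p.support ∧
      ∀ a ∈ q.support, a ∈ S → a = z := by
  classical
  suffices ∃ (z : V) (q : G.Walk x z), z ∈ S ∧ q.support ⊆ p.support ∧
      ∀ a ∈ q.support, a ∈ S → a = z by
    obtain ⟨z, q, hz, hq, hS⟩ := this
    exact ⟨z, q.bypass, hz, q.bypass_isPath, fun a ha => hq (q.support_bypass_subset_support ha),
      fun a ha => hS a (q.support_bypass_subset_support ha)⟩
  induction p with
  | nil => exact ⟨_, .nil, hy, by simp, by simp⟩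
  | @cons a b c hab p ih =>
    by_cases ha : a ∈ S
    · exact ⟨a, .nil, ha, by simp, by simp⟩
    · obtain ⟨z, q, hz, hq, hS⟩ := ih hy
      refine ⟨z, .cons hab q, hz, ?_, ?_⟩
      · intro i hi
        simp only [Walk.support_cons, List.mem_cons] at hi ⊢
        exact hi.imp id fun h => hq h
      · intro i hi hiS
        simp only [Walk.support_cons, List.mem_cons] at hi
        rcases hi with rfl | hi
        · exact absurd hiS ha
        · exact hS i hi hiS

lemma Walk.IsPath.replace_middle {s a b t : V} {p : G.Walk s a} {m : G.Walk a b}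
    {q : G.Walk b t} (h : (p.append (m.append q)).IsPath) (hab : a ≠ b) {e : G.Walk a b}
    (he : e.IsPath) (hep : ∀ x ∈ e.support, x ∈ p.support → x = a)
    (heq : ∀ x ∈ e.support, x ∈ q.support → x = b) :
    (p.append (e.append q)).IsPath := by
  have hq := h.of_append_right.of_append_right
  refine h.of_append_left.append_of_inter (he.append_of_inter hq heq) fun x hxp hx => ?_
  rw [Walk.mem_support_append_iff] at hx
  rcases hx with hx | hx
  · exact hep x hx hxp
  · have hxa : x = a := h.inter_of_append hxp (by simp [Walk.mem_support_append_iff, hx])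
    subst hxa
    exact absurd (h.of_append_right.inter_of_append m.start_mem_support hx) hab

/-- A path can be rerouted along an ear attached at two distinct vertices of it. -/
lemma Walk.IsPath.exists_isPath_through_ear {s t a b : V} {p : G.Walk s t} (hp : p.IsPath)
    (ha : a ∈ p.support) (hb : b ∈ p.support) (hab : a ≠ b) {e : G.Walk a b} (he : e.IsPath)
    (hep : ∀ x ∈ e.support, x ∈ p.support → x = a ∨ x = b) :
    ∃ q : G.Walk s t, q.IsPath ∧ e.support ⊆ q.support := by
  classical
  have key : ∀ {a b : V} {p₁ : G.Walk s a} {m : G.Walk a b} {p₂ : G.Walk b t}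
      {e : G.Walk a b}, (p₁.append (m.append p₂)).IsPath → a ≠ b → e.IsPath →
      (∀ x ∈ e.support, x ∈ (p₁.append (m.append p₂)).support → x = a ∨ x = b) →
      ∃ q : G.Walk s t, q.IsPath ∧ e.support ⊆ q.support := by
    intro a b p₁ m p₂ e h hab he hep
    refine ⟨p₁.append (e.append p₂), h.replace_middle hab he ?_ ?_, ?_⟩
    · intro x hxe hxp
      rcases hep x hxe (by simp [Walk.mem_support_append_iff, hxp]) with hx | rfl
      · exact hx
      · exact h.inter_of_append hxp (by simp [Walk.mem_support_append_iff])
    · intro x hxe hxp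
      rcases hep x hxe (by simp [Walk.mem_support_append_iff, hxp]) with rfl | hx
      · exact h.of_append_right.inter_of_append m.start_mem_support hxp
      · exact hx
    · intro x hx
      simp [Walk.mem_support_append_iff, hx]
  by_cases hb' : b ∈ (p.dropUntil a ha).support
  · have hsplit : (p.takeUntil a ha).append
        (((p.dropUntil a ha).takeUntil b hb').append ((p.dropUntil a ha).dropUntil b hb')) = p := by
      rw [Walk.take_spec, Walk.take_spec]
    exact key (hsplit.symm ▸ hp) hab he (hsplit.symm ▸ hep)
  · have hb'' : b ∈ (p.takeUntil a ha).support := by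
      rw [← Walk.take_spec p ha, Walk.mem_support_append_iff] at hb
      exact hb.resolve_right hb'
    have hsplit : ((p.takeUntil a ha).takeUntil b hb'').append
        (((p.takeUntil a ha).dropUntil b hb'').append (p.dropUntil a ha)) = p := by
      rw [Walk.append_assoc, Walk.take_spec, Walk.take_spec]
    obtain ⟨q, hq, hs⟩ := key (e := e.reverse) (hsplit.symm ▸ hp) hab.symm he.reverse
      (fun x hx hxp => (hep x (by simpa using hx) (hsplit ▸ hxp)).symm)
    exact ⟨q, hq, fun x hx => hs (by simpa using hx)⟩

end Paths

/-- Joining two finite trees by an edge gives a tree. -/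
lemma IsTree.sum_sup_edge {ι κ : Type*} [Finite ι] [Finite κ] {S : SimpleGraph ι}
    {T : SimpleGraph κ} (hS : S.IsTree) (hT : T.IsTree) (i : ι) (j : κ) :
    (S.sum T ⊔ edge (.inl i) (.inr j)).IsTree := by
  rw [isTree_iff_connected_and_card] at hS hT ⊢
  refine ⟨hS.1.sum_sup_edge hT.1, ?_⟩
  have hne : (Sum.inl i : ι ⊕ κ) ≠ Sum.inr j := by simp
  have hnot : s(Sum.inl i, Sum.inr j) ∉ (S.sum T).edgeSet := by
    rw [mem_edgeSet]; exact not_adj_sum_inl_inr _ _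
  rw [edgeSet_sup, edgeSet_edge_of_ne hne, Nat.card_coe_set_eq, Set.union_singleton,
    Set.ncard_insert_of_notMem hnot, ← Nat.card_coe_set_eq, Nat.card_congr edgeSetSumEquiv,
    Nat.card_sum, Nat.card_sum]
  omega

end SimpleGraph

open SimpleGraph

section Relevant

variable {V : Type} {G : SimpleGraph V} {s t : V}

/-- A walk avoiding the relevant set attaches to at most one relevant vertex. -/
lemma relevantSet_attachment_unique {a b x y : V} (ha : a ∈ relevantSet G s t)
    (hb : b ∈ relevantSet G s t) (p : G.Walk x y) (hp : ∀ z ∈ p.support, z ∉ relevantSet G s t)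
    (hax : G.Adj a x) (hyb : G.Adj y b) : a = b := by
  classical
  by_contra hab
  obtain ⟨P, hP, haP⟩ := id ha
  obtain ⟨Q, hQ, hbQ⟩ := id hb
  have hPR : ∀ z ∈ P.support, z ∈ relevantSet G s t := fun z hz => ⟨P, hP, hz⟩
  have hQR : ∀ z ∈ Q.support, z ∈ relevantSet G s t := fun z hz => ⟨Q, hQ, hz⟩
  obtain ⟨d, m, hd, hmQ, ham⟩ : ∃ (d : V) (m : G.Walk b d), d ∈ P.support ∧
      m.support ⊆ Q.support ∧ a ∉ m.support := by
    by_cases h : a ∈ (Q.takeUntil b hbQ).support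
    · refine ⟨t, Q.dropUntil b hbQ, P.end_mem_support, Q.support_dropUntil_subset_support _, ?_⟩
      intro h'
      have hQ' : ((Q.takeUntil b hbQ).append (Q.dropUntil b hbQ)).IsPath := by
        rwa [Walk.take_spec]
      exact hab (hQ'.inter_of_append h h')
    · refine ⟨s, (Q.takeUntil b hbQ).reverse, P.start_mem_support, ?_, by simpa using h⟩
      intro z hz
      exact Q.support_takeUntil_subset_support _ (by simpa using hz)
  obtain ⟨c, q, hc, hq, hqm, hqP⟩ := m.exists_isPath_first_hit {z | z ∈ P.support} hd
  have hqR : ∀ z ∈ q.support, z ∈ relevantSet G s t := fun z hz => hQR z (hmQ (hqm hz))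
  have haq : a ∉ q.support := fun h => ham (hqm h)
  have hac : a ≠ c := fun h => haq (h ▸ q.end_mem_support)
  have hpb : ∀ z ∈ p.bypass.support, z ∉ relevantSet G s t := fun z hz =>
    hp z (p.support_bypass_subset_support hz)
  have hyq : (Walk.cons hyb q).IsPath := by
    rw [Walk.cons_isPath_iff]
    exact ⟨hq, fun h => hp y p.end_mem_support (hqR y h)⟩
  have hear : (Walk.cons hax (p.bypass.append (Walk.cons hyb q))).IsPath := by
    rw [Walk.cons_isPath_iff]
    refine ⟨p.bypass_isPath.append_of_inter hyq ?_, ?_⟩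
    · intro z hz hz'
      rw [Walk.support_cons, List.mem_cons] at hz'
      exact hz'.resolve_right fun h => hpb z hz (hqR z h)
    · rw [Walk.mem_support_append_iff, Walk.support_cons, List.mem_cons]
      rintro (h | rfl | h)
      · exact hpb a h ha
      · exact hp _ p.end_mem_support ha
      · exact haq h
  obtain ⟨W, hW, hsub⟩ := hP.exists_isPath_through_ear haP hc hac hear (by
    intro z hz hzP
    rw [Walk.support_cons, List.mem_cons, Walk.mem_support_append_iff, Walk.support_cons,
      List.mem_cons] at hz
    rcases hz with h | h | rfl | h
    · exact Or.inl h
    · exact absurd (hPR z hzP) (hpb z h)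
    · exact absurd (hPR _ hzP) (hp _ p.end_mem_support)
    · exact Or.inr (hqP z h hzP))
  exact hp x p.start_mem_support ⟨W, hW, hsub (by simp)⟩

/-- The vertices of `G` retract onto the relevant set so that every edge is either inside the
relevant set or inside a fibre of the retraction. -/
lemma exists_retraction_relevantSet (G : SimpleGraph V) (s t : V)
    (hs : s ∈ relevantSet G s t) :
    ∃ f : V → V, (∀ v, f v ∈ relevantSet G s t) ∧ (∀ v ∈ relevantSet G s t, f v = v) ∧
      ∀ x y, G.Adj x y →
        (x ∈ relevantSet G s t ∧ y ∈ relevantSet G s t) ∨ f x = f y := by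
  classical
  set R := relevantSet G s t with hR
  let A : V → V → Prop := fun v r =>
    r ∈ R ∧ ∃ (y : V) (p : G.Walk v y), (∀ z ∈ p.support, z ∉ R) ∧ G.Adj y r
  let g : V → V := fun v => if h : ∃ r, A v r then h.choose else s
  have hgA : ∀ v r, A v r → g v = r := by
    intro v r hr
    have h : ∃ r, A v r := ⟨r, hr⟩
    have hg : g v = h.choose := dif_pos h
    obtain ⟨hcR, y, p, hp, hy⟩ := h.choose_spec
    obtain ⟨hrR, y', p', hp', hy'⟩ := hr
    rw [hg]
    refine relevantSet_attachment_unique hcR hrR (p.reverse.append p') ?_ hy.symm hy'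
    intro z hz
    rw [Walk.mem_support_append_iff] at hz
    rcases hz with hz | hz
    · exact hp z (by simpa using hz)
    · exact hp' z hz
  have hgR : ∀ v, g v ∈ R := by
    intro v
    by_cases h : ∃ r, A v r
    · have hg : g v = h.choose := dif_pos h
      rw [hg]
      exact h.choose_spec.1
    · have hg : g v = s := dif_neg h
      rw [hg]
      exact hs
  have hstep : ∀ x y, G.Adj x y → x ∉ R → ∀ r, A y r → A x r := by
    rintro x y hxy hx r ⟨hr, z, p, hp, hz⟩
    refine ⟨hr, z, .cons hxy p, ?_, hz⟩
    intro i hi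
    rw [Walk.support_cons, List.mem_cons] at hi
    rcases hi with rfl | hi
    · exact hx
    · exact hp i hi
  have hout : ∀ x y, G.Adj x y → x ∉ R → y ∈ R → g x = y := fun x y hxy hx hy =>
    hgA x y ⟨hy, x, .nil, by simpa using hx, hxy⟩
  have hadj : ∀ x y, G.Adj x y → x ∉ R → y ∉ R → g x = g y := by
    intro x y hxy hx hy
    by_cases h : ∃ r, A y r
    · obtain ⟨r, hr⟩ := h
      rw [hgA y r hr, hgA x r (hstep x y hxy hx r hr)]
    · have h' : ¬ ∃ r, A x r := fun ⟨r, hr⟩ => h ⟨r, hstep y x hxy.symm hy r hr⟩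
      have h1 : g x = s := dif_neg h'
      have h2 : g y = s := dif_neg h
      rw [h1, h2]
  refine ⟨fun v => if v ∈ R then v else g v, ?_, ?_, ?_⟩
  · intro v
    by_cases hv : v ∈ R
    · simp [hv]
    · simpa [hv] using hgR v
  · intro v hv
    simp [hv]
  · intro x y hxy
    by_cases hx : x ∈ R <;> by_cases hy : y ∈ R
    · exact Or.inl ⟨hx, hy⟩
    · right; simp [hx, hy, hout y x hxy.symm hy hx]
    · right; simp [hx, hy, hout x y hxy hx hy]
    · right; simp [hx, hy, hadj x y hxy hx hy]

end Relevant

/-- The part of `K` inside `A` has a tree decomposition with bags of size at most `n`. -/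
def HasDecompOn {V : Type} (K : SimpleGraph V) (A : Set V) (n : ℕ) : Prop :=
  ∃ (ι : Type) (_ : Fintype ι) (T : SimpleGraph ι) (bag : ι → Finset V), T.IsTree ∧
    (∀ i, ∀ v ∈ bag i, v ∈ A) ∧ (∀ i, (bag i).card ≤ n) ∧
    (∀ v ∈ A, (SimpleGraph.induce {i | v ∈ bag i} T).Connected) ∧
    ∀ u ∈ A, ∀ v ∈ A, K.Adj u v → ∃ i, u ∈ bag i ∧ v ∈ bag i

section Decomp

variable {V W : Type}

lemma TreeDecomp.width_le_iff {G : SimpleGraph V} (td : TreeDecomp G) (w : ℕ) :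
    td.width ≤ w ↔ ∀ i, (td.bag i).card ≤ w + 1 := by
  unfold TreeDecomp.width
  rw [Nat.sub_le_iff_le_add, Finset.sup_le_iff]
  simp

lemma exists_treeDecomp_of_treewidth_le [Finite V] {G : SimpleGraph V} {w : ℕ}
    (h : treewidth G ≤ w) : ∃ td : TreeDecomp G, ∀ i, (td.bag i).card ≤ w + 1 := by
  have := Fintype.ofFinite V
  have hne : {w | ∃ td : TreeDecomp G, td.width = w}.Nonempty :=
    ⟨_, { ι := Unit
          instFin := inferInstance
          T := ⊥
          isTree := IsTree.of_subsingleton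
          bag := fun _ => Finset.univ
          bag_conn := fun v => by
            have : Nonempty {i : Unit | v ∈ (Finset.univ : Finset V)} := ⟨⟨(), by simp⟩⟩
            exact (IsTree.of_subsingleton).1
          bag_edge := fun _ _ _ => ⟨(), by simp, by simp⟩ }, rfl⟩
  obtain ⟨td, htd⟩ := Nat.sInf_mem hne
  exact ⟨td, (td.width_le_iff w).1 (htd.trans_le h)⟩

lemma HasDecompOn.treewidth_le {K : SimpleGraph V} {w : ℕ}
    (h : HasDecompOn K Set.univ (w + 1)) : treewidth K ≤ w := by
  obtain ⟨ι, hι, T, bag, hT, -, hcard, hconn, hedge⟩ := h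
  let td : TreeDecomp K := ⟨ι, hι, T, hT, bag, fun v => hconn v trivial,
    fun u v => hedge u trivial v trivial⟩
  exact (Nat.sInf_le ⟨td, rfl⟩ : treewidth K ≤ td.width).trans ((td.width_le_iff w).2 hcard)

/-- Pulling back a tree decomposition along an injective homomorphism. -/
lemma TreeDecomp.hasDecompOn {K : SimpleGraph V} {L : SimpleGraph W} (td : TreeDecomp L)
    {n : ℕ} (hn : ∀ i, (td.bag i).card ≤ n) {A : Set V} (f : A → W)
    (hf : Function.Injective f) (hKL : ∀ x y : A, K.Adj x y → L.Adj (f x) (f y)) :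
    HasDecompOn K A n := by
  classical
  have hmem : ∀ i (v : V) (hv : v ∈ A),
      v ∈ ((td.bag i).preimage f hf.injOn).map (Function.Embedding.subtype _) ↔
        f ⟨v, hv⟩ ∈ td.bag i := by
    intro i v hv
    simp [hv]
  refine ⟨td.ι, td.instFin, td.T,
    fun i => ((td.bag i).preimage f hf.injOn).map (Function.Embedding.subtype _),
    td.isTree, ?_, ?_, ?_, ?_⟩
  · intro i v hv
    rw [Finset.mem_map] at hv
    obtain ⟨x, -, rfl⟩ := hv
    exact x.2
  · intro i
    rw [Finset.card_map, Finset.card_preimage]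
    exact (Finset.card_filter_le _ _).trans (hn i)
  · intro v hv
    have h := td.bag_conn (f ⟨v, hv⟩)
    have hset : {i | f ⟨v, hv⟩ ∈ td.bag i} = {i | v ∈
        ((td.bag i).preimage f hf.injOn).map (Function.Embedding.subtype _)} :=
      Set.ext fun i => (hmem i v hv).symm
    rwa [hset] at h
  · intro u hu v hv huv
    obtain ⟨i, h1, h2⟩ := td.bag_edge (hKL ⟨u, hu⟩ ⟨v, hv⟩ huv)
    exact ⟨i, (hmem i u hu).2 h1, (hmem i v hv).2 h2⟩

/-- Gluing tree decompositions along a single vertex. -/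
lemma HasDecompOn.union {K : SimpleGraph V} {A B : Set V} {n : ℕ} {r : V}
    (hA : HasDecompOn K A n) (hB : HasDecompOn K B n) (hrA : r ∈ A) (hrB : r ∈ B)
    (hAB : ∀ v, v ∈ A → v ∈ B → v = r)
    (hK : ∀ x ∈ A ∪ B, ∀ y ∈ A ∪ B, K.Adj x y → (x ∈ A ∧ y ∈ A) ∨ (x ∈ B ∧ y ∈ B)) :
    HasDecompOn K (A ∪ B) n := by
  obtain ⟨ι, _, S, bag, hS, hsub, hcard, hconn, hedge⟩ := hA
  obtain ⟨κ, _, T, bag', hT, hsub', hcard', hconn', hedge'⟩ := hB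
  obtain ⟨i₀, hi₀⟩ := (hconn r hrA).nonempty
  obtain ⟨j₀, hj₀⟩ := (hconn' r hrB).nonempty
  refine ⟨ι ⊕ κ, inferInstance, S.sum T ⊔ edge (.inl i₀) (.inr j₀), Sum.elim bag bag',
    hS.sum_sup_edge hT i₀ j₀, ?_, ?_, ?_, ?_⟩
  · rintro (i | j) v hv
    · exact Or.inl (hsub i v hv)
    · exact Or.inr (hsub' j v hv)
  · rintro (i | j)
    · exact hcard i
    · exact hcard' j
  · intro v hv
    by_cases hvA : v ∈ A <;> by_cases hvB : v ∈ B
    · obtain rfl := hAB v hvA hvB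
      let φ : ((S.induce {i | v ∈ bag i}).sum (T.induce {j | v ∈ bag' j}) ⊔
          edge (.inl ⟨i₀, hi₀⟩) (.inr ⟨j₀, hj₀⟩)) →g
          (S.sum T ⊔ edge (.inl i₀) (.inr j₀)).induce
            {k | v ∈ Sum.elim bag bag' k} :=
        { toFun := Sum.elim (fun i => ⟨.inl i.1, i.2⟩) (fun j => ⟨.inr j.1, j.2⟩)
          map_rel' := by
            rintro (⟨a, ha⟩ | ⟨a, ha⟩) (⟨b, hb⟩ | ⟨b, hb⟩) h <;>
              simpa [edge_adj] using h }
      refine Connected.map φ ?_ ((hconn v hvA).sum_sup_edge (hconn' v hvB))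
      rintro ⟨i | j, h⟩
      · exact ⟨.inl ⟨i, h⟩, rfl⟩
      · exact ⟨.inr ⟨j, h⟩, rfl⟩
    · let φ : S.induce {i | v ∈ bag i} →g
          (S.sum T ⊔ edge (.inl i₀) (.inr j₀)).induce {k | v ∈ Sum.elim bag bag' k} :=
        { toFun := fun i => ⟨.inl i.1, i.2⟩
          map_rel' := by
            rintro ⟨a, ha⟩ ⟨b, hb⟩ h
            simpa [edge_adj] using h }
      refine Connected.map φ ?_ (hconn v hvA)
      rintro ⟨i | j, h⟩
      · exact ⟨⟨i, h⟩, rfl⟩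
      · exact absurd (hsub' j v h) hvB
    · let φ : T.induce {j | v ∈ bag' j} →g
          (S.sum T ⊔ edge (.inl i₀) (.inr j₀)).induce {k | v ∈ Sum.elim bag bag' k} :=
        { toFun := fun j => ⟨.inr j.1, j.2⟩
          map_rel' := by
            rintro ⟨a, ha⟩ ⟨b, hb⟩ h
            simpa [edge_adj] using h }
      refine Connected.map φ ?_ (hconn' v hvB)
      rintro ⟨i | j, h⟩
      · exact absurd (hsub i v h) hvA
      · exact ⟨⟨j, h⟩, rfl⟩
    · exact absurd hv (by simp [hvA, hvB])
  · intro x hx y hy hxy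
    rcases hK x hx y hy hxy with ⟨h1, h2⟩ | ⟨h1, h2⟩
    · obtain ⟨i, hi⟩ := hedge x h1 y h2 hxy
      exact ⟨.inl i, hi⟩
    · obtain ⟨j, hj⟩ := hedge' x h1 y h2 hxy
      exact ⟨.inr j, hj⟩

/-- If `f` retracts the vertices onto `R` and every edge lies inside `R` or inside a fibre of `f`,
then decompositions of `R` and of the fibres glue together. -/
lemma HasDecompOn.of_retraction [Finite V] {K : SimpleGraph V} {R : Set V} {n : ℕ} {f : V → V}
    (hfR : ∀ v, f v ∈ R) (hf : ∀ v ∈ R, f v = v)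
    (hK : ∀ x y, K.Adj x y → (x ∈ R ∧ y ∈ R) ∨ f x = f y) (hR : HasDecompOn K R n)
    (hfib : ∀ r ∈ R, HasDecompOn K {v | f v = r} n) : HasDecompOn K Set.univ n := by
  classical
  have := Fintype.ofFinite V
  have key : ∀ S : Finset V, HasDecompOn K (R ∪ {v | f v ∈ S}) n := by
    intro S
    induction S using Finset.induction_on with
    | empty => simpa using hR
    | insert r S hrS ih =>
      by_cases hr : r ∈ R
      · have hset : R ∪ {v | f v ∈ insert r S} = (R ∪ {v | f v ∈ S}) ∪ {v | f v = r} := by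
          ext v
          simp only [Set.mem_union, Set.mem_ofPred_eq, Finset.mem_insert]
          tauto
        rw [hset]
        refine ih.union (hfib r hr) (Or.inl hr) (hf r hr) ?_ ?_
        · rintro v (hv | hv) hvr
          · rw [← hf v hv]
            exact hvr
          · exact absurd (hvr ▸ hv : r ∈ S) hrS
        · intro x hx y hy hxy
          rcases hK x y hxy with ⟨h1, h2⟩ | h
          · exact Or.inl ⟨Or.inl h1, Or.inl h2⟩
          · simp only [Set.mem_union, Set.mem_ofPred_eq] at hx hy ⊢
            rw [h] at hx ⊢
            tauto
      · have hset : R ∪ {v | f v ∈ insert r S} = R ∪ {v | f v ∈ S} := by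
          ext v
          have : f v ≠ r := fun h => hr (h ▸ hfR v)
          simp [this]
        rwa [hset]
  simpa using key Finset.univ

end Decomp

/-- If `H ≤ G` is a spanning subgraph with `tw(H) ≤ w`, and `uv` is an edge of the
`(s,t)`-relevant part of `G` with `tw(H + uv) > w`, then `tw(G_{s,t} + st) > w`. -/
theorem stmt_11 {V : Type} [Fintype V] (w : ℕ) (G H : SimpleGraph V) (hHG : H ≤ G)
    (s t : V) (hst : s ≠ t) (htwH : treewidth H ≤ w)
    (u v : V) (hu : u ∈ relevantSet G s t) (hv : v ∈ relevantSet G s t) (huv : G.Adj u v)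
    (htwHuv : w < treewidth (addEdge H u v)) :
    ∃ (hs : s ∈ relevantSet G s t) (ht : t ∈ relevantSet G s t),
      w < treewidth (addEdge (SimpleGraph.induce (relevantSet G s t) G) ⟨s, hs⟩ ⟨t, ht⟩) := by
  classical
  obtain ⟨P, hP, -⟩ := id hu
  have hs : s ∈ relevantSet G s t := ⟨P, hP, P.start_mem_support⟩
  have ht : t ∈ relevantSet G s t := ⟨P, hP, P.end_mem_support⟩
  refine ⟨hs, ht, ?_⟩
  by_contra! hle
  obtain ⟨tdR, htdR⟩ := exists_treeDecomp_of_treewidth_le hle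
  obtain ⟨tdH, htdH⟩ := exists_treeDecomp_of_treewidth_le htwH
  obtain ⟨f, hfR, hf, hfG⟩ := exists_retraction_relevantSet G s t hs
  have hadj : ∀ x y, (addEdge H u v).Adj x y → H.Adj x y ∨ (x = u ∧ y = v ∨ x = v ∧ y = u) := by
    intro x y h
    simp only [addEdge, sup_adj, fromEdgeSet_adj, Set.mem_singleton_iff, Sym2.eq_iff] at h
    tauto
  have hKG : ∀ x y, (addEdge H u v).Adj x y → G.Adj x y := by
    intro x y h
    rcases hadj x y h with h | ⟨rfl, rfl⟩ | ⟨rfl, rfl⟩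
    · exact hHG h
    · exact huv
    · exact huv.symm
  refine htwHuv.not_ge (HasDecompOn.treewidth_le (HasDecompOn.of_retraction hfR hf
    (fun x y h => hfG x y (hKG x y h)) ?_ fun r _ => ?_))
  · exact tdR.hasDecompOn htdR id Function.injective_id fun x y h =>
      Or.inl (hKG x y h)
  · refine tdH.hasDecompOn htdH Subtype.val Subtype.val_injective ?_
    rintro ⟨x, hx⟩ ⟨y, hy⟩ h
    refine (hadj x y h).resolve_right fun hxy => huv.ne ?_
    have hxy' : f x = f y := hx.trans hy.symm
    rw [← hf u hu, ← hf v hv]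
    rcases hxy with ⟨rfl, rfl⟩ | ⟨rfl, rfl⟩
    · exact hxy'
    · exact hxy'.symm
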